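/- Fix an integer d ≥ 2. The function G_{−1} is strictly monotonically increasing on (0,∞), satisfies 0 < G_{−1}(z) < 1 for every z > 0, and has the limits G_{−1}(z) → 0 as z → 0⁺ and G_{−1}(z) → 1 as z → ∞. In particular, G_{−1} maps (0,∞) bijectively onto (0,1). -/

import Mathlib

open MeasureTheory Real Filter

/-- The modified Bessel function of the second kind, defined via its integral
representation `K_ν(z) = ∫_0^∞ exp(−z cosh t) cosh(ν t) dt`. -/
noncomputable def besselK (ν z : ℝ) : ℝ :=
  ∫ t in Set.Ioi (0:ℝ), Real.exp (-z * Real.cosh t) * Real.cosh (ν * t)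

/-- The ratio `G_k(z) = K_{(d+1)/2+k}(z) / K_{(d+1)/2}(z)`. -/
noncomputable def G (d k : ℤ) (z : ℝ) : ℝ :=
  besselK (((d : ℝ) + 1) / 2 + (k : ℝ)) z / besselK (((d : ℝ) + 1) / 2) z

open Set Topology

lemma exp_neg_mul_cosh_mul_exp_le {z t : ℝ} (hz : 0 < z) (ht : 0 ≤ t) (a : ℝ) :
    exp (-z * cosh t) * exp (a * t) ≤ exp ((a + 1) ^ 2 / z) * exp (-t) := by
  rw [← exp_add, ← exp_add, exp_le_exp]
  have hcosh : t ^ 2 / 4 ≤ cosh t := by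
    have h₁ := quadratic_le_exp_of_nonneg ht
    have h₂ := exp_pos (-t)
    rw [cosh_eq]
    linarith
  have hz_cosh := mul_le_mul_of_nonneg_left hcosh hz.le
  have hsq : (a + 1) ^ 2 / z - (a + 1) * t + z * (t ^ 2 / 4)
      = (a + 1 - z * t / 2) ^ 2 / z := by
    field_simp
    ring
  have hnonneg : 0 ≤ (a + 1 - z * t / 2) ^ 2 / z := by positivity
  linarith

lemma cosh_mul_le_exp_abs_mul (ν : ℝ) {t : ℝ} (ht : 0 ≤ t) : cosh (ν * t) ≤ exp (|ν| * t) := by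
  rw [← cosh_abs, abs_mul, abs_of_nonneg ht, cosh_eq]
  have : exp (-(|ν| * t)) ≤ exp (|ν| * t) := exp_le_exp.2 (neg_le_self (by positivity))
  linarith

lemma exp_neg_mul_cosh_mul_cosh_le {z t : ℝ} (hz : 0 < z) (ht : 0 ≤ t) (ν : ℝ) :
    exp (-z * cosh t) * cosh (ν * t) ≤ exp ((|ν| + 1) ^ 2 / z) * exp (-t) :=
  (mul_le_mul_of_nonneg_left (cosh_mul_le_exp_abs_mul ν ht) (exp_pos _).le).trans
    (exp_neg_mul_cosh_mul_exp_le hz ht _)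

lemma integrableOn_const_mul_exp_neg (C : ℝ) :
    IntegrableOn (fun t : ℝ => C * exp (-t)) (Ioi 0) := by
  simpa [IntegrableOn] using (exp_neg_integrableOn_Ioi 0 one_pos).const_mul C

lemma integrableOn_besselK (ν : ℝ) {z : ℝ} (hz : 0 < z) :
    IntegrableOn (fun t : ℝ => exp (-z * cosh t) * cosh (ν * t)) (Ioi 0) := by
  refine (integrableOn_const_mul_exp_neg (exp ((|ν| + 1) ^ 2 / z))).mono'
    (Continuous.aestronglyMeasurable (by fun_prop)) ?_
  filter_upwards [ae_restrict_mem measurableSet_Ioi] with t ht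
  rw [norm_of_nonneg (mul_nonneg (exp_pos _).le (cosh_pos _).le)]
  exact exp_neg_mul_cosh_mul_cosh_le hz (le_of_lt ht) ν

lemma setIntegral_Ioi_pos {f : ℝ → ℝ} {a b : ℝ} (hab : a ≤ b) (hf : IntegrableOn f (Ioi a))
    (h0 : ∀ t ∈ Ioi a, 0 ≤ f t) (hpos : ∀ t ∈ Ioi b, 0 < f t) : 0 < ∫ t in Ioi a, f t := by
  rw [setIntegral_pos_iff_support_of_nonneg_ae
    ((ae_restrict_mem measurableSet_Ioi).mono h0) hf]
  refine lt_of_lt_of_le ?_ (measure_mono (s := Ioi b) fun t ht =>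
    ⟨(hpos t ht).ne', lt_of_le_of_lt hab ht⟩)
  simp

lemma besselK_pos (ν : ℝ) {z : ℝ} (hz : 0 < z) : 0 < besselK ν z :=
  setIntegral_Ioi_pos le_rfl (integrableOn_besselK ν hz)
    (fun _ _ => (mul_pos (exp_pos _) (cosh_pos _)).le)
    (fun _ _ => mul_pos (exp_pos _) (cosh_pos _))

lemma besselK_le_besselK {μ ν z : ℝ} (hz : 0 < z) (h : |μ| ≤ |ν|) :
    besselK μ z ≤ besselK ν z := by
  refine setIntegral_mono (integrableOn_besselK μ hz) (integrableOn_besselK ν hz) fun t => ?_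
  refine mul_le_mul_of_nonneg_left (cosh_le_cosh.2 ?_) (exp_pos _).le
  rw [abs_mul, abs_mul]
  gcongr

lemma besselK_lt_besselK {μ ν z : ℝ} (hz : 0 < z) (h : |μ| < |ν|) :
    besselK μ z < besselK ν z := by
  rw [← sub_pos, besselK, besselK,
    ← integral_sub (integrableOn_besselK ν hz) (integrableOn_besselK μ hz)]
  have hpos : ∀ t ∈ Ioi (0 : ℝ),
      0 < exp (-z * cosh t) * cosh (ν * t) - exp (-z * cosh t) * cosh (μ * t) := by
    intro t ht
    rw [← mul_sub]
    refine mul_pos (exp_pos _) (sub_pos.2 (cosh_lt_cosh.2 ?_))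
    rw [abs_mul, abs_mul]
    exact mul_lt_mul_of_pos_right h (abs_pos.2 (ne_of_gt ht))
  exact setIntegral_Ioi_pos le_rfl
    ((integrableOn_besselK ν hz).sub (integrableOn_besselK μ hz))
    (fun t ht => (hpos t ht).le) hpos

lemma continuousOn_besselK (ν : ℝ) : ContinuousOn (besselK ν) (Ioi 0) := by
  intro z₀ hz₀
  have hz₀ : 0 < z₀ := hz₀
  refine ContinuousAt.continuousWithinAt ?_
  refine continuousAt_of_dominated (bound := fun t => exp (-(z₀ / 2) * cosh t) * cosh (ν * t))
    (Eventually.of_forall fun z => Continuous.aestronglyMeasurable (by fun_prop)) ?_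
    (integrableOn_besselK ν (half_pos hz₀))
    (Eventually.of_forall fun t => by fun_prop)
  filter_upwards [lt_mem_nhds (half_lt_self hz₀)] with z hz
  refine Eventually.of_forall fun t => ?_
  rw [norm_of_nonneg (mul_nonneg (exp_pos _).le (cosh_pos _).le)]
  have hcosh := cosh_pos t
  gcongr

/-- The three-term recurrence of the modified Bessel functions of the second kind. -/
lemma besselK_add_one_sub_besselK_sub_one (μ : ℝ) {z : ℝ} (hz : 0 < z) :
    z * (besselK (μ + 1) z - besselK (μ - 1) z) = 2 * μ * besselK μ z := by
  have hderiv : ∀ t ∈ Ici (0 : ℝ), HasDerivAt (fun t => exp (-z * cosh t) * sinh (μ * t))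
      (μ * (exp (-z * cosh t) * cosh (μ * t))
        - z / 2 * (exp (-z * cosh t) * cosh ((μ + 1) * t)
          - exp (-z * cosh t) * cosh ((μ - 1) * t))) t := by
    intro t _
    have h₁ : HasDerivAt (fun t => exp (-z * cosh t)) (exp (-z * cosh t) * (-z * sinh t)) t :=
      ((hasDerivAt_cosh t).const_mul (-z)).exp
    have h₂ : HasDerivAt (fun t => sinh (μ * t)) (cosh (μ * t) * (μ * 1)) t :=
      ((hasDerivAt_id t).const_mul μ).sinh
    refine (h₁.mul h₂).congr_deriv ?_
    rw [add_mul, sub_mul, one_mul, cosh_add, cosh_sub]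
    ring
  have hdiff : IntegrableOn (fun t => z / 2 * (exp (-z * cosh t) * cosh ((μ + 1) * t)
      - exp (-z * cosh t) * cosh ((μ - 1) * t))) (Ioi 0) := ((integrableOn_besselK (μ + 1) hz).sub
    (integrableOn_besselK (μ - 1) hz)).const_mul (z / 2)
  have hmain := (integrableOn_besselK μ hz).const_mul μ
  have hlim : Tendsto (fun t => exp (-z * cosh t) * sinh (μ * t)) atTop (𝓝 0) := by
    have hbound : Tendsto (fun t : ℝ => exp ((|μ| + 1) ^ 2 / z) * exp (-t)) atTop (𝓝 0) := by
      simpa using tendsto_exp_neg_atTop_nhds_zero.const_mul (exp ((|μ| + 1) ^ 2 / z))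
    refine squeeze_zero_norm' ?_ hbound
    filter_upwards [eventually_ge_atTop 0] with t ht
    refine le_trans ?_ (exp_neg_mul_cosh_mul_cosh_le hz ht μ)
    rw [norm_mul, norm_of_nonneg (exp_pos _).le]
    refine mul_le_mul_of_nonneg_left ?_ (exp_pos _).le
    rw [norm_eq_abs, abs_le]
    have h₁ := exp_pos (μ * t)
    have h₂ := exp_pos (-(μ * t))
    rw [sinh_eq, cosh_eq]
    constructor <;> linarith
  have key := integral_Ioi_of_hasDerivAt_of_tendsto' hderiv (hmain.sub hdiff) hlim
  rw [integral_sub hmain hdiff, integral_const_mul, integral_const_mul,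
    integral_sub (integrableOn_besselK (μ + 1) hz) (integrableOn_besselK (μ - 1) hz)] at key
  simp only [mul_zero, sinh_zero, sub_zero] at key
  simp only [besselK]
  linarith

lemma cosh_mul_cosh_lt {μ ν s t : ℝ} (hμ : 0 ≤ μ) (hμν : μ < ν) (hs : 0 ≤ s) (hst : s < t) :
    cosh (μ * t) * cosh (ν * s) < cosh (μ * s) * cosh (ν * t) := by
  have hprod : ∀ x y : ℝ, cosh x * cosh y = (cosh (x + y) + cosh (x - y)) / 2 := by
    intro x y
    rw [cosh_add, cosh_sub]
    ring
  have hsub : 0 < (ν - μ) * (t - s) := mul_pos (sub_pos.2 hμν) (sub_pos.2 hst)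
  have hadd : 0 ≤ (ν - μ) * (t + s) := mul_nonneg (sub_pos.2 hμν).le (by linarith)
  have hadd' : 0 ≤ (ν + μ) * (t - s) := mul_nonneg (by linarith) (by linarith)
  have h₁ : cosh (μ * t + ν * s) < cosh (μ * s + ν * t) := by
    rw [cosh_lt_cosh, abs_of_nonneg (by
      nlinarith [mul_nonneg hμ hs, mul_nonneg hμ (hs.trans hst.le)])]
    exact lt_of_lt_of_le (by nlinarith) (le_abs_self _)
  have h₂ : cosh (μ * t - ν * s) ≤ cosh (μ * s - ν * t) := by
    rw [cosh_le_cosh, abs_sub_comm (μ * s)]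
    exact (abs_le.2 ⟨by nlinarith, by nlinarith⟩).trans (le_abs_self _)
  rw [hprod, hprod]
  linarith

/-- For `0 ≤ μ < ν` the ratio `K_μ / K_ν` is strictly increasing: `cosh (μ t) - c * cosh (ν t)`
changes sign exactly once on `(0, ∞)`, while the weight `exp (-z cosh t)` moves mass towards `0`
as `z` grows. -/
lemma strictMonoOn_besselK_div_besselK {μ ν : ℝ} (hμ : 0 ≤ μ) (hμν : μ < ν) :
    StrictMonoOn (fun z => besselK μ z / besselK ν z) (Ioi 0) := by
  intro z hz w hw hzw
  have hz : 0 < z := hz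
  have hw : 0 < w := hw
  have hν := hμ.trans_lt hμν
  set c := besselK μ z / besselK ν z with hc
  have hc_lt : c < 1 := by
    rw [hc, div_lt_one (besselK_pos ν hz)]
    exact besselK_lt_besselK hz (by rwa [abs_of_nonneg hμ, abs_of_pos hν])
  have hint : ∀ {x : ℝ}, 0 < x →
      IntegrableOn (fun t => exp (-x * cosh t) * (cosh (μ * t) - c * cosh (ν * t))) (Ioi 0) := by
    intro x hx
    refine ((integrableOn_besselK μ hx).sub ((integrableOn_besselK ν hx).const_mul c)).congr
      (Eventually.of_forall fun t => ?_)
    simp only [Pi.sub_apply]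
    ring
  have hval : ∀ {x : ℝ}, 0 < x →
      ∫ t in Ioi 0, exp (-x * cosh t) * (cosh (μ * t) - c * cosh (ν * t))
        = besselK μ x - c * besselK ν x := by
    intro x hx
    rw [besselK, besselK, ← integral_const_mul,
      ← integral_sub (integrableOn_besselK μ hx) ((integrableOn_besselK ν hx).const_mul c)]
    congr 1 with t
    ring
  have hzero : besselK μ z - c * besselK ν z = 0 := by
    rw [hc, div_mul_cancel₀ _ (besselK_pos ν hz).ne', sub_self]
  obtain ⟨t₀, ht₀, hroot⟩ : ∃ t₀, 0 ≤ t₀ ∧ cosh (μ * t₀) - c * cosh (ν * t₀) = 0 := by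
    by_contra! hne
    have hcont : Continuous fun t => cosh (μ * t) - c * cosh (ν * t) := by fun_prop
    have hpos : ∀ t ∈ Ioi (0 : ℝ), 0 < cosh (μ * t) - c * cosh (ν * t) := by
      intro t ht
      by_contra! hle
      obtain ⟨s, hs, hs0⟩ := intermediate_value_Icc' (le_of_lt ht) hcont.continuousOn
        (show (0 : ℝ) ∈ Icc _ _ from ⟨hle, by simpa using hc_lt.le⟩)
      exact hne s hs.1 hs0
    have := setIntegral_Ioi_pos le_rfl (hint hz)
      (fun t ht => (mul_pos (exp_pos _) (hpos t ht)).le)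
      (fun t ht => mul_pos (exp_pos _) (hpos t ht))
    rw [hval hz, hzero] at this
    exact this.false
  have hroot' : cosh (μ * t₀) = c * cosh (ν * t₀) := sub_eq_zero.1 hroot
  have hg := cosh_pos (ν * t₀)
  have hpos_left : ∀ t, 0 ≤ t → t < t₀ → 0 < cosh (μ * t) - c * cosh (ν * t) := by
    intro t ht htt
    have := cosh_mul_cosh_lt hμ hμν ht htt
    rw [hroot'] at this
    by_contra! hle
    nlinarith
  have hneg_right : ∀ t, t₀ < t → cosh (μ * t) - c * cosh (ν * t) < 0 := by
    intro t htt
    have := cosh_mul_cosh_lt hμ hμν ht₀ htt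
    rw [hroot'] at this
    by_contra! hle
    nlinarith
  set q := exp (-(w - z) * cosh t₀) with hq
  have hsplit : ∀ t, exp (-w * cosh t) = exp (-z * cosh t) * exp (-(w - z) * cosh t) := by
    intro t
    rw [← exp_add]
    ring_nf
  have hfactor : ∀ t, exp (-w * cosh t) * (cosh (μ * t) - c * cosh (ν * t))
      - q * (exp (-z * cosh t) * (cosh (μ * t) - c * cosh (ν * t)))
      = exp (-z * cosh t) * ((exp (-(w - z) * cosh t) - q)
        * (cosh (μ * t) - c * cosh (ν * t))) := by
    intro t
    rw [hsplit]
    ring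
  have hright : ∀ t, t₀ < t → 0 < exp (-w * cosh t) * (cosh (μ * t) - c * cosh (ν * t))
      - q * (exp (-z * cosh t) * (cosh (μ * t) - c * cosh (ν * t))) := by
    intro t htt
    rw [hfactor]
    refine mul_pos (exp_pos _) (mul_pos_of_neg_of_neg ?_ (hneg_right t htt))
    have hcosh : cosh t₀ < cosh t := cosh_strictMonoOn ht₀ (ht₀.trans htt.le) htt
    rw [sub_neg, hq, exp_lt_exp]
    nlinarith
  have hleft : ∀ t, 0 ≤ t → t < t₀ → 0 < exp (-w * cosh t) * (cosh (μ * t) - c * cosh (ν * t))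
      - q * (exp (-z * cosh t) * (cosh (μ * t) - c * cosh (ν * t))) := by
    intro t ht htt
    rw [hfactor]
    refine mul_pos (exp_pos _) (mul_pos ?_ (hpos_left t ht htt))
    have hcosh : cosh t < cosh t₀ := cosh_strictMonoOn ht ht₀ htt
    rw [sub_pos, hq, exp_lt_exp]
    nlinarith
  have hpos := setIntegral_Ioi_pos ht₀ ((hint hw).sub ((hint hz).const_mul q)) (fun t ht => by
    rcases lt_trichotomy t t₀ with h | h | h
    · exact (hleft t (le_of_lt ht) h).le
    · simp [h, hroot]
    · exact (hright t h).le) hright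
  simp only [Pi.sub_apply] at hpos
  rw [integral_sub (hint hw) ((hint hz).const_mul q), integral_const_mul, hval hw, hval hz, hzero,
    mul_zero, sub_zero, sub_pos] at hpos
  exact (lt_div_iff₀ (besselK_pos ν hw)).2 hpos

lemma besselK_div_besselK_add_one_le {μ z : ℝ} (hμ : 0 < μ) (hz : 0 < z) :
    besselK μ z / besselK (μ + 1) z ≤ z / (2 * μ) := by
  rw [div_le_div_iff₀ (besselK_pos _ hz) (by positivity)]
  have h := besselK_add_one_sub_besselK_sub_one μ hz
  have hpos := mul_pos hz (besselK_pos (μ - 1) hz)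
  linarith

lemma le_besselK_div_besselK_add_one {μ z : ℝ} (hμ : 1 / 2 ≤ μ) (hz : 0 < z) :
    z / (z + 2 * μ) ≤ besselK μ z / besselK (μ + 1) z := by
  rw [div_le_div_iff₀ (by linarith) (besselK_pos _ hz)]
  have h := besselK_add_one_sub_besselK_sub_one μ hz
  have hle : besselK (μ - 1) z ≤ besselK μ z := besselK_le_besselK hz <| by
    rw [abs_of_nonneg (by linarith : 0 ≤ μ), abs_le]
    constructor <;> linarith
  have := mul_le_mul_of_nonneg_left hle hz.le
  linarith

lemma besselK_div_besselK_add_one_lt_one {μ z : ℝ} (hμ : 0 ≤ μ) (hz : 0 < z) :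
    besselK μ z / besselK (μ + 1) z < 1 := by
  rw [div_lt_one (besselK_pos _ hz)]
  refine besselK_lt_besselK hz ?_
  rw [abs_of_nonneg hμ, abs_of_nonneg (by linarith)]
  linarith

lemma tendsto_besselK_div_besselK_add_one_nhdsGT_zero {μ : ℝ} (hμ : 0 < μ) :
    Tendsto (fun z => besselK μ z / besselK (μ + 1) z) (𝓝[>] 0) (𝓝 0) := by
  have hbound : Tendsto (fun z : ℝ => z / (2 * μ)) (𝓝[>] 0) (𝓝 0) := by
    have : Continuous fun z : ℝ => z / (2 * μ) := by fun_prop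
    simpa using (this.tendsto 0).mono_left nhdsWithin_le_nhds
  refine squeeze_zero' ?_ ?_ hbound <;> filter_upwards [self_mem_nhdsWithin] with z hz
  · exact (div_pos (besselK_pos _ hz) (besselK_pos _ hz)).le
  · exact besselK_div_besselK_add_one_le hμ hz

lemma tendsto_besselK_div_besselK_add_one_atTop {μ : ℝ} (hμ : 1 / 2 ≤ μ) :
    Tendsto (fun z => besselK μ z / besselK (μ + 1) z) atTop (𝓝 1) := by
  have hbound : Tendsto (fun z : ℝ => z / (z + 2 * μ)) atTop (𝓝 1) := by
    have h₀ : Tendsto (fun z : ℝ => 1 - 2 * μ / (z + 2 * μ)) atTop (𝓝 (1 - 0)) :=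
      tendsto_const_nhds.sub
        (tendsto_const_nhds.div_atTop (tendsto_atTop_add_const_right _ _ tendsto_id))
    rw [sub_zero] at h₀
    refine h₀.congr' ?_
    filter_upwards [eventually_gt_atTop 0] with z hz
    have : z + 2 * μ ≠ 0 := by linarith
    field_simp
    ring
  refine tendsto_of_tendsto_of_tendsto_of_le_of_le' hbound tendsto_const_nhds ?_ ?_ <;>
    filter_upwards [eventually_gt_atTop 0] with z hz
  · exact le_besselK_div_besselK_add_one hμ hz
  · exact (besselK_div_besselK_add_one_lt_one (by linarith) hz).le

/-- `G_{−1}` is strictly monotonically increasing on `(0,∞)`, takes values in `(0,1)`,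
tends to `0` as `z → 0⁺` and to `1` as `z → ∞`, and maps `(0,∞)` bijectively onto `(0,1)`. -/
theorem G_neg_one_strictMono (d : ℤ) (hd : 2 ≤ d) :
    StrictMonoOn (G d (-1)) (Set.Ioi 0) ∧
    (∀ z : ℝ, 0 < z → 0 < G d (-1) z ∧ G d (-1) z < 1) ∧
    Tendsto (G d (-1)) (nhdsWithin 0 (Set.Ioi 0)) (nhds 0) ∧
    Tendsto (G d (-1)) atTop (nhds 1) ∧
    Set.BijOn (G d (-1)) (Set.Ioi 0) (Set.Ioo 0 1) := by
  obtain ⟨μ, hμ⟩ : ∃ μ : ℝ, μ = ((d : ℝ) - 1) / 2 := ⟨_, rfl⟩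
  have hd' : (2 : ℝ) ≤ d := by exact_mod_cast hd
  have hμ_half : 1 / 2 ≤ μ := by linarith
  have hμ_pos : 0 < μ := by linarith
  have hG : G d (-1) = fun z => besselK μ z / besselK (μ + 1) z := by
    have h₁ : ((d : ℝ) + 1) / 2 + ((-1 : ℤ) : ℝ) = μ := by
      push_cast
      linarith
    have h₂ : ((d : ℝ) + 1) / 2 = μ + 1 := by linarith
    funext z
    rw [G, h₁, h₂]
  rw [hG]
  have hmono := strictMonoOn_besselK_div_besselK hμ_pos.le (lt_add_one μ)
  have hrange : ∀ z : ℝ, 0 < z → 0 < besselK μ z / besselK (μ + 1) z ∧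
      besselK μ z / besselK (μ + 1) z < 1 := fun z hz =>
    ⟨div_pos (besselK_pos _ hz) (besselK_pos _ hz),
      besselK_div_besselK_add_one_lt_one hμ_pos.le hz⟩
  have hzero := tendsto_besselK_div_besselK_add_one_nhdsGT_zero hμ_pos
  have hone := tendsto_besselK_div_besselK_add_one_atTop hμ_half
  have hcont : ContinuousOn (fun z => besselK μ z / besselK (μ + 1) z) (Ioi 0) :=
    (continuousOn_besselK μ).div (continuousOn_besselK _) fun z hz => (besselK_pos _ hz).ne'
  exact ⟨hmono, hrange, hzero, hone, hrange, hmono.injOn,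
    isPreconnected_Ioi.intermediate_value_Ioo (l₁ := 𝓝[>] 0) inf_le_right
      (le_principal_iff.2 (Ioi_mem_atTop 0)) hcont hzero hone⟩
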